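/- The set ĉ of almost convergent sequences is strongly lower porous as a subset of the metric space S of bounded sequences with convergent arithmetic means (with the metric induced by the supremum norm). -/

import Mathlib

open Filter
open scoped ENNReal Topology

noncomputable section

/-- `ℓ∞`: the Banach space of bounded real sequences with the supremum norm. -/
abbrev LInf : Type := lp (fun _ : ℕ => ℝ) ∞

/-- `x` is almost convergent to `s`: the window means `(x_j + ⋯ + x_{j+n-1})/n` tend to `s`
uniformly in `j`. -/
def AlmostConvTo (x : ℕ → ℝ) (s : ℝ) : Prop :=
  TendstoUniformly (fun (n : ℕ) (j : ℕ) => (∑ i ∈ Finset.range n, x (j + i)) / n)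
    (fun _ => s) atTop

/-- `γ(x,R,E) = sup {r > 0 : ∃ z, B(z,r) ⊆ B(x,R) \ E}`. -/
noncomputable def porGamma {X : Type*} [PseudoMetricSpace X] (x : X) (R : ℝ) (E : Set X) :
    ℝ :=
  sSup {r : ℝ | 0 < r ∧ ∃ z : X, Metric.ball z r ⊆ Metric.ball x R \ E}

/-- `E` is strongly lower porous: at every point `x ∈ E` the lower porosity
`2 · liminf_{R → 0⁺} γ(x,R,E)/R` equals `1`. -/
def StronglyLowerPorous {X : Type*} [PseudoMetricSpace X] (E : Set X) : Prop :=
  ∀ x ∈ E, 2 * liminf (fun R : ℝ => porGamma x R E / R) (𝓝[>] 0) = 1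

/-- `S`, the metric space of bounded sequences whose arithmetic means converge,
with the sup-norm metric. -/
abbrev spaceS : Type :=
  {y : LInf // ∃ l : ℝ, Tendsto (fun n : ℕ => (∑ i ∈ Finset.range n, y i) / n) atTop (nhds l)}

/-- The set of squares, as reals. -/
def sqSet : Set ℝ := Set.range (fun m : ℕ => ((m : ℝ)) ^ 2)

/-- Distance to the nearest square. -/
def sqD (n : ℕ) : ℝ := Metric.infDist (n : ℝ) sqSet

lemma sqD_lip (n : ℕ) : |sqD (n + 1) - sqD n| ≤ 1 := by
  have h := (Metric.lipschitz_infDist_pt sqSet).dist_le_mul ((n + 1 : ℕ) : ℝ) (n : ℝ)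
  simpa [Real.dist_eq, sqD] using h

lemma sqD_nonneg (n : ℕ) : 0 ≤ sqD n := Metric.infDist_nonneg

lemma sqD_le (n m : ℕ) : sqD n ≤ |(n : ℝ) - (m : ℝ) ^ 2| :=
  Metric.infDist_le_dist_of_mem (Set.mem_range_self m)

lemma sqD_sq (m : ℕ) : sqD (m ^ 2) = 0 := by
  have h := sqD_le (m ^ 2) m
  push_cast at h
  simp only [sub_self, abs_zero] at h
  exact le_antisymm h (sqD_nonneg _)

lemma le_sqD (n : ℕ) (c : ℝ) (h : ∀ m : ℕ, c ≤ |(n : ℝ) - (m : ℝ) ^ 2|) : c ≤ sqD n := by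
  refine (Metric.le_infDist (Set.range_nonempty _)).2 ?_
  rintro _ ⟨m, rfl⟩
  exact h m

lemma sqD_mid (k n : ℕ) (h1 : k ^ 2 + k ≤ n) (h2 : n + k ≤ (k + 1) ^ 2) : (k : ℝ) ≤ sqD n := by
  apply le_sqD
  intro m
  have h1' : (k : ℝ) ^ 2 + k ≤ n := by exact_mod_cast h1
  have h2' : (n : ℝ) + k ≤ (k + 1) ^ 2 := by exact_mod_cast h2
  rcases Nat.lt_or_ge k m with h | h
  · have : ((k : ℝ) + 1) ^ 2 ≤ (m : ℝ) ^ 2 := by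
      exact_mod_cast Nat.pow_le_pow_left h 2
    rw [abs_sub_comm]
    exact le_trans (by linarith) (le_abs_self _)
  · have : (m : ℝ) ^ 2 ≤ (k : ℝ) ^ 2 := by
      exact_mod_cast Nat.pow_le_pow_left h 2
    exact le_trans (by linarith) (le_abs_self _)

/-- The perturbing sequence. -/
def uSeq (n : ℕ) : ℝ := sqD (n + 1) - sqD n

lemma uSeq_sum (j n : ℕ) : ∑ i ∈ Finset.range n, uSeq (j + i) = sqD (j + n) - sqD j := by
  have := Finset.sum_range_sub (fun i => sqD (j + i)) n
  simpa [uSeq, add_assoc] using this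

lemma sqD_bound (n : ℕ) : sqD n ≤ 2 * √(n : ℝ) := by
  refine (sqD_le n (Nat.sqrt n)).trans ?_
  have h1 : ((Nat.sqrt n : ℕ) : ℝ) ^ 2 ≤ n := by exact_mod_cast Nat.sqrt_le' n
  have h2 : (n : ℝ) ≤ (Nat.sqrt n : ℝ) ^ 2 + 2 * Nat.sqrt n := by
    have : n < (Nat.sqrt n + 1) ^ 2 := Nat.lt_succ_sqrt' n
    have : n ≤ (Nat.sqrt n) ^ 2 + 2 * Nat.sqrt n := by nlinarith
    exact_mod_cast this
  have h3 : (Nat.sqrt n : ℝ) ≤ √(n : ℝ) := Real.nat_sqrt_le_real_sqrt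
  rw [abs_of_nonneg (by linarith)]
  linarith

lemma uSeq_mean : Tendsto (fun n : ℕ => (∑ i ∈ Finset.range n, uSeq i) / n) atTop (𝓝 0) := by
  have h0 : sqD 0 = 0 := by simpa using sqD_sq 0
  have hs : ∀ n, ∑ i ∈ Finset.range n, uSeq i = sqD n := by
    intro n
    have := uSeq_sum 0 n
    simpa [h0] using this
  have hl : Tendsto (fun n : ℕ => 2 * (√(n : ℝ))⁻¹) atTop (𝓝 0) := by
    have : Tendsto (fun n : ℕ => (√(n : ℝ))⁻¹) atTop (𝓝 0) :=
      tendsto_inv_atTop_zero.comp (Real.tendsto_sqrt_atTop.comp tendsto_natCast_atTop_atTop)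
    simpa using this.const_mul 2
  refine squeeze_zero (fun n => ?_) (fun n => ?_) hl
  · rw [hs]; exact div_nonneg (sqD_nonneg n) (Nat.cast_nonneg n)
  · rw [hs]
    calc sqD n / n ≤ 2 * √(n : ℝ) / n := by
          gcongr; exact sqD_bound n
      _ = 2 * (√(n : ℝ))⁻¹ := by
          rw [mul_div_assoc, Real.sqrt_div_self', one_div]

lemma not_almost (w : ℕ → ℝ) (c ρ : ℝ) (hρ : ρ < c) (hw : ∀ i, |w i - c * uSeq i| ≤ ρ) (s : ℝ) :
    ¬ AlmostConvTo w s := by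
  intro h
  have hr0 : 0 ≤ ρ := (abs_nonneg _).trans (hw 0)
  have h' := Metric.tendstoUniformly_iff.1 h (c - ρ) (by linarith)
  obtain ⟨k, hk, hk1⟩ := (h'.and (eventually_ge_atTop 1)).exists
  have hkp : (0 : ℝ) < k := by exact_mod_cast hk1
  have key : ∀ j, |∑ i ∈ Finset.range k, w (j + i) - c * (sqD (j + k) - sqD j)| ≤ k * ρ := by
    intro j
    rw [← uSeq_sum, Finset.mul_sum, ← Finset.sum_sub_distrib]
    refine (Finset.abs_sum_le_sum_abs _ _).trans ?_
    refine (Finset.sum_le_sum (fun i _ => hw (j + i))).trans ?_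
    simp
  have hA := hk (k ^ 2)
  have hB := hk (k ^ 2 + k + 1)
  have kA := (abs_le.1 (key (k ^ 2))).1
  have kB := (abs_le.1 (key (k ^ 2 + k + 1))).2
  have e1 : k ^ 2 + k + 1 + k = (k + 1) ^ 2 := by ring
  rw [e1, sqD_sq] at kB
  rw [sqD_sq] at kA
  have m1 := sqD_mid k (k ^ 2 + k) le_rfl (by nlinarith)
  have m2 := sqD_mid k (k ^ 2 + k + 1) (by omega) (by nlinarith)
  have hc : 0 < c := by linarith
  have n1 := mul_le_mul_of_nonneg_left m1 hc.le
  have n2 := mul_le_mul_of_nonneg_left m2 hc.le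
  rw [Real.dist_eq, abs_lt] at hA hB
  have a1 : c - ρ ≤ (∑ i ∈ Finset.range k, w (k ^ 2 + i)) / k := by
    rw [le_div_iff₀ hkp]; nlinarith
  have b1 : (∑ i ∈ Finset.range k, w (k ^ 2 + k + 1 + i)) / k ≤ -(c - ρ) := by
    rw [div_le_iff₀ hkp]; nlinarith
  linarith [hA.1, hB.2]

lemma AlmostConvTo.sub' {x y : ℕ → ℝ} {s t : ℝ} (hx : AlmostConvTo x s) (hy : AlmostConvTo y t) :
    AlmostConvTo (fun n => x n - y n) (s - t) := by
  have h := TendstoUniformly.sub hx hy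
  unfold AlmostConvTo
  convert h using 1
  · funext n j
    simp [Finset.sum_sub_distrib, sub_div]
  · rfl

/-- The predicate defining `S`. -/
lemma memS_add (a b : LInf) (c : ℝ)
    (ha : ∃ l : ℝ, Tendsto (fun n : ℕ => (∑ i ∈ Finset.range n, a i) / n) atTop (nhds l))
    (hb : ∃ l : ℝ, Tendsto (fun n : ℕ => (∑ i ∈ Finset.range n, b i) / n) atTop (nhds l)) :
    ∃ l : ℝ, Tendsto (fun n : ℕ => (∑ i ∈ Finset.range n, (a + c • b : LInf) i) / n)
      atTop (nhds l) := by
  obtain ⟨l, hl⟩ := ha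
  obtain ⟨m, hm⟩ := hb
  refine ⟨l + c * m, ?_⟩
  refine (hl.add (hm.const_mul c)).congr ?_
  intro n
  simp only [lp.coeFn_add, lp.coeFn_smul, Pi.add_apply, Pi.smul_apply, smul_eq_mul,
    Finset.sum_add_distrib, ← Finset.mul_sum]
  ring

/-- The perturbing sequence as an element of `ℓ∞`. -/
def uL : LInf := ⟨uSeq, memℓp_infty ⟨1, by rintro _ ⟨n, rfl⟩; exact sqD_lip n⟩⟩

lemma uL_norm : ‖uL‖ ≤ 1 := lp.norm_le_of_forall_le zero_le_one (fun n => sqD_lip n)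

lemma porGamma_eq (x : spaceS)
    (hx : ∃ s : ℝ, AlmostConvTo (fun n => (x : LInf) n) s) (R : ℝ) (hR : 0 < R) :
    porGamma x R {x : spaceS | ∃ s : ℝ, AlmostConvTo (fun n => (x : LInf) n) s} = R / 2 := by
  refine IsGreatest.csSup_eq ⟨⟨by linarith, ?_⟩, ?_⟩
  · have hzx : ‖(R / 2) • uL‖ ≤ R / 2 := by
      rw [norm_smul, Real.norm_of_nonneg (by linarith)]
      nlinarith [uL_norm]
    refine ⟨⟨x.1 + (R / 2) • uL, memS_add _ _ _ x.2 ⟨0, uSeq_mean⟩⟩, ?_⟩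
    intro y hy
    rw [Metric.mem_ball, Subtype.dist_eq, dist_eq_norm] at hy
    refine ⟨?_, ?_⟩
    · rw [Metric.mem_ball, Subtype.dist_eq, dist_eq_norm]
      have : (y : LInf) - x = (y - (x.1 + (R / 2) • uL)) + (R / 2) • uL := by abel
      rw [this]
      refine (norm_add_le _ _).trans_lt ?_
      have hy' : ‖(y : LInf) - (x.1 + (R / 2) • uL)‖ < R / 2 := hy
      linarith
    · rintro ⟨s, hs⟩
      obtain ⟨t, ht⟩ := hx
      refine not_almost _ (R / 2) _ hy (fun i => ?_) _ (hs.sub' ht)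
      have := lp.norm_apply_le_norm ENNReal.top_ne_zero ((y : LInf) - (x.1 + (R / 2) • uL)) i
      refine le_trans (le_of_eq ?_) this
      rw [Real.norm_eq_abs]
      congr 1
      simp only [lp.coeFn_add, lp.coeFn_sub, lp.coeFn_smul, Pi.add_apply, Pi.sub_apply,
        Pi.smul_apply, smul_eq_mul]
      have : (uL : ℕ → ℝ) i = uSeq i := rfl
      rw [this]; ring
  · rintro r ⟨hr, z, hz⟩
    have hD : r ≤ ‖(z : LInf) - x‖ := by
      by_contra hlt
      push Not at hlt
      have : x ∈ Metric.ball z r := by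
        rw [Metric.mem_ball, dist_comm, Subtype.dist_eq, dist_eq_norm]; exact hlt
      exact (hz this).2 hx
    have hDp : 0 < ‖(z : LInf) - x‖ := hr.trans_le hD
    have : r ≤ R - ‖(z : LInf) - x‖ := by
      by_contra hlt
      push Not at hlt
      obtain ⟨τ, h1, h2⟩ := exists_between (max_lt hlt hr)
      have hτ0 : 0 < τ := (le_max_right _ _).trans_lt h1
      have hτR := (le_max_left _ _).trans_lt h1
      set D := ‖(z : LInf) - x‖ with hDdef
      have hd : ∃ l : ℝ, Tendsto (fun n : ℕ => (∑ i ∈ Finset.range n,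
          ((z : LInf) - x : LInf) i) / n) atTop (nhds l) := by
        have := memS_add z.1 x.1 (-1) z.2 x.2
        have e : z.1 + (-1 : ℝ) • x.1 = (z : LInf) - x := by
          rw [neg_one_smul, sub_eq_add_neg]
        rwa [e] at this
      let v : spaceS := ⟨z.1 + (τ / D) • ((z : LInf) - x), memS_add _ _ _ z.2 hd⟩
      have hv : v ∈ Metric.ball z r := by
        rw [Metric.mem_ball, Subtype.dist_eq, dist_eq_norm]
        change ‖z.1 + (τ / D) • ((z : LInf) - x) - z.1‖ < r
        rw [add_sub_cancel_left, norm_smul, Real.norm_of_nonneg (by positivity), ← hDdef,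
          div_mul_cancel₀ _ hDp.ne']
        exact h2
      have hv2 := (hz hv).1
      rw [Metric.mem_ball, Subtype.dist_eq, dist_eq_norm] at hv2
      change ‖z.1 + (τ / D) • ((z : LInf) - x) - x.1‖ < R at hv2
      have e : z.1 + (τ / D) • ((z : LInf) - x) - x.1 = (1 + τ / D) • ((z : LInf) - x) := by
        rw [add_smul, one_smul]; abel
      rw [e, norm_smul, Real.norm_of_nonneg (by positivity), ← hDdef, add_mul, one_mul,
        div_mul_cancel₀ _ hDp.ne'] at hv2
      linarith
    linarith

/-- The set `ĉ` of almost convergent sequences is strongly lower porous in `S`. -/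
theorem stmt9 :
    StronglyLowerPorous
      {x : spaceS | ∃ s : ℝ, AlmostConvTo (fun n => (x : LInf) n) s} := by
  intro x hx
  have h : (fun R : ℝ => porGamma x R
      {x : spaceS | ∃ s : ℝ, AlmostConvTo (fun n => (x : LInf) n) s} / R)
      =ᶠ[𝓝[>] 0] fun _ => (1 / 2 : ℝ) := by
    filter_upwards [self_mem_nhdsWithin] with R hR
    have hR' : (0 : ℝ) < R := hR
    rw [porGamma_eq x hx R hR']
    field_simp
  rw [liminf_congr h, liminf_const]
  norm_num
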